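/- Let K be a field and R = K[x_i : i ∈ ℕ]. Let f, g ∈ R have widths a = w(f) and b = w(g), and let ρ₁, ρ₂ ∈ Inc(ℕ). Then there exist ρ ∈ Inc(ℕ) and strictly increasing functions σ₁, σ₂ ∈ Inc(ℕ) with σ₁({0,…,a−1}) ⊆ {0,…,a+b−1} and σ₂({0,…,b−1}) ⊆ {0,…,a+b−1}, such that ρ₁·f = ρ·(σ₁·f) and ρ₂·g = ρ·(σ₂·g). -/

import Mathlib

open MvPolynomial

/-- The width of a polynomial `f ∈ K[x_0, x_1, …]`: the smallest `n` such that every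
variable occurring in `f` has index `< n`. -/
noncomputable def width {K : Type*} [CommSemiring K] (f : MvPolynomial ℕ K) : ℕ :=
  sInf {n | ∀ i ∈ f.vars, i < n}

theorem lt_width_of_mem_vars {K : Type*} [CommSemiring K] (f : MvPolynomial ℕ K) :
    ∀ i ∈ f.vars, i < width f := by
  have hne : {n | ∀ i ∈ f.vars, i < n}.Nonempty :=
    ⟨f.vars.sup id + 1, fun i hi => Nat.lt_succ_of_le (Finset.le_sup (f := id) hi)⟩
  exact Nat.sInf_mem hne

theorem rename_congr_width {K : Type*} [CommSemiring K] (f : MvPolynomial ℕ K)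
    (u v : ℕ → ℕ) (h : ∀ i < width f, u i = v i) : rename u f = rename v f := by
  rw [rename_eq_aeval, rename_eq_aeval]
  exact eval₂Hom_congr' rfl
    (fun i hi _ => by simp [h i (lt_width_of_mem_vars f i hi)]) rfl

theorem exists_sigma (S : Finset ℕ) (N c M : ℕ) (hN : ∀ n ∈ S, n < N) (hM : S.card ≤ M)
    (p : ℕ → Prop) (hp : ∀ n, p n ↔ n ∈ S ∨ N ≤ n)
    (r : ℕ → ℕ) (hr : StrictMono r) (hS : ∀ i < c, r i ∈ S) :
    ∃ s : ℕ → ℕ, StrictMono s ∧ (∀ i < c, s i < M) ∧ ∀ i < c, Nat.nth p (s i) = r i := by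
  classical
  have hlt : ∀ i < c, Nat.count p (r i) < M := by
    intro i hi
    refine lt_of_lt_of_le ?_ hM
    rw [Nat.count_eq_card_filter_range]
    apply Finset.card_lt_card
    rw [Finset.ssubset_iff_of_subset]
    · exact ⟨r i, hS i hi, by simp⟩
    · intro n hn
      simp only [Finset.mem_filter, Finset.mem_range, hp] at hn
      have := hN _ (hS i hi)
      rcases hn.2 with h | h
      · exact h
      · omega
  refine ⟨fun i => if i < c then Nat.count p (r i) else M + i, ?_, ?_, ?_⟩
  · intro i j hij
    dsimp only
    by_cases hj : j < c
    · have hi : i < c := hij.trans hj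
      rw [if_pos hi, if_pos hj]
      exact Nat.count_strict_mono ((hp _).2 (Or.inl (hS i hi))) (hr hij)
    · rw [if_neg hj]
      split_ifs with hi
      · have := hlt i hi
        omega
      · omega
  · intro i hi
    simpa [hi] using hlt i hi
  · intro i hi
    simp only [hi, if_true]
    exact Nat.nth_count ((hp _).2 (Or.inl (hS i hi)))

/-- Interlacing: for `f, g` of widths `a, b` and `ρ₁, ρ₂ ∈ Inc(ℕ)`, there are
`ρ ∈ Inc(ℕ)` and strictly increasing `σ₁, σ₂` mapping `{0,…,a−1}` resp. `{0,…,b−1}`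
into `{0,…,a+b−1}` with `ρ₁·f = ρ·(σ₁·f)` and `ρ₂·g = ρ·(σ₂·g)`. -/
theorem interlacing {K : Type*} [Field K] (f g : MvPolynomial ℕ K)
    (ρ₁ ρ₂ : ℕ → ℕ) (h₁ : StrictMono ρ₁) (h₂ : StrictMono ρ₂) :
    ∃ (ρ σ₁ σ₂ : ℕ → ℕ), StrictMono ρ ∧ StrictMono σ₁ ∧ StrictMono σ₂ ∧
      (∀ i < width f, σ₁ i < width f + width g) ∧
      (∀ i < width g, σ₂ i < width f + width g) ∧
      rename ρ₁ f = rename ρ (rename σ₁ f) ∧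
      rename ρ₂ g = rename ρ (rename σ₂ g) := by
  classical
  let S : Finset ℕ := (Finset.range (width f)).image ρ₁ ∪ (Finset.range (width g)).image ρ₂
  let N : ℕ := S.sup id + 1
  have hN : ∀ n ∈ S, n < N := fun n hn => Nat.lt_succ_of_le (Finset.le_sup (f := id) hn)
  have hM : S.card ≤ width f + width g := by
    refine (Finset.card_union_le _ _).trans (Nat.add_le_add ?_ ?_)
    · simpa using Finset.card_image_le (s := Finset.range (width f)) (f := ρ₁)
    · simpa using Finset.card_image_le (s := Finset.range (width g)) (f := ρ₂)
  let p : ℕ → Prop := fun n => n ∈ S ∨ N ≤ n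
  have hinf : (setOf p).Infinite :=
    (Set.Ici_infinite N).mono (fun n hn => Or.inr hn)
  obtain ⟨σ₁, m₁, b₁, e₁⟩ := exists_sigma S N (width f) _ hN hM p (fun _ => Iff.rfl) ρ₁ h₁
    (fun i hi => Finset.mem_union_left _ (Finset.mem_image_of_mem _ (Finset.mem_range.2 hi)))
  obtain ⟨σ₂, m₂, b₂, e₂⟩ := exists_sigma S N (width g) _ hN hM p (fun _ => Iff.rfl) ρ₂ h₂
    (fun i hi => Finset.mem_union_right _ (Finset.mem_image_of_mem _ (Finset.mem_range.2 hi)))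
  refine ⟨Nat.nth p, σ₁, σ₂, Nat.nth_strictMono hinf, m₁, m₂, b₁, b₂, ?_, ?_⟩
  · rw [rename_rename]
    exact rename_congr_width f _ _ (fun i hi => (e₁ i hi).symm)
  · rw [rename_rename]
    exact rename_congr_width g _ _ (fun i hi => (e₂ i hi).symm)
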